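/- arXiv:2110.10583 — 4 statements merged into one kernel-verified Lean document; each statement's English description precedes it below -/
import Mathlib

section
/- Let a be a complex number and u > 0 a real number. Define c₀(u) = Γ(a, u) and, for n ≥ 1, c_n(u) = (1/n!)·(d/du)^n Γ(a, u), i.e. c_n(u) = −(1/n!)·(d/du)^(n−1) [u^(a−1) e^(−u)]. Then for every integer n ≥ 0, the coefficients satisfy the recurrence u (n+1)(n+2) c_{n+2}(u) + (n+1)(n + 1 + u − a) c_{n+1}(u) + n c_n(u) = 0. -/
open Set MeasureTheory
open scoped ContDiff

/-- The incomplete gamma integrand is integrable away from the origin, for every `a`. -/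
theorem integrableOn_incGamma_integrand (a : ℂ) {w : ℝ} (hw : 0 < w) :
    IntegrableOn (fun t : ℝ => (t : ℂ) ^ (a - 1) * Complex.exp (-(t : ℂ))) (Ioi w) := by
  have hcont : ContinuousOn (fun t : ℝ => Real.exp (-t) * t ^ (a.re - 1)) (Ici w) :=
    continuousOn_id.neg.rexp.mul
      (continuousOn_id.rpow_const fun t ht => Or.inl (hw.trans_le ht).ne')
  have hreal : IntegrableOn (fun t : ℝ => Real.exp (-t) * t ^ (a.re - 1)) (Ioi w) :=
    integrable_of_isBigO_exp_neg one_half_pos hcont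
      (Real.Gamma_integrand_isLittleO _).isBigO
  refine Integrable.mono' hreal ?_ ?_
  · refine ContinuousOn.aestronglyMeasurable (fun t ht => ?_) measurableSet_Ioi
    have ht' : 0 < t := hw.trans ht
    exact ((Complex.continuousAt_ofReal_cpow_const t _ (Or.inr ht'.ne')).mul
      (by fun_prop)).continuousWithinAt
  · refine (ae_restrict_iff' measurableSet_Ioi).2 (.of_forall fun t ht => ?_)
    rw [norm_mul, Complex.norm_cpow_eq_rpow_re_of_pos (hw.trans ht), Complex.norm_exp, mul_comm]
    simp

theorem contDiffOn_incGamma_integrand (a : ℂ) :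
    ContDiffOn ℝ ∞ (fun t : ℝ => (t : ℂ) ^ (a - 1) * Complex.exp (-(t : ℂ))) (Ioi 0) := by
  have hlog : ContDiffOn ℝ ∞ (fun t : ℝ => (Real.log t : ℂ)) (Ioi 0) :=
    Complex.ofRealCLM.contDiff.comp_contDiffOn
      (Real.contDiffOn_log.mono fun t ht => (mem_Ioi.1 ht).ne')
  have hid : ContDiffOn ℝ ∞ (fun t : ℝ => (t : ℂ)) (Ioi 0) :=
    Complex.ofRealCLM.contDiff.contDiffOn
  refine ((hlog.mul (contDiffOn_const (c := a - 1))).cexp.mul hid.neg.cexp).congr fun t ht => ?_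
  rw [Complex.cpow_def_of_ne_zero (Complex.ofReal_ne_zero.2 (mem_Ioi.1 ht).ne'),
    Complex.ofReal_log (mem_Ioi.1 ht).le]

theorem hasDerivAt_incGamma_integrand (a : ℂ) {w : ℝ} (hw : 0 < w) :
    HasDerivAt (fun t : ℝ => (t : ℂ) ^ (a - 1) * Complex.exp (-(t : ℂ)))
      ((a - 1 - w) / w * ((w : ℂ) ^ (a - 1) * Complex.exp (-(w : ℂ)))) w := by
  have hw' : (w : ℂ) ≠ 0 := Complex.ofReal_ne_zero.2 hw.ne'
  have hpow : HasDerivAt (fun z : ℂ => z ^ (a - 1)) ((a - 1) * (w : ℂ) ^ (a - 1 - 1)) w :=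
    (hasDerivAt_id (w : ℂ)).cpow_const (Complex.ofReal_mem_slitPlane.2 hw) |>.congr_deriv (by simp)
  refine ((hpow.mul (hasDerivAt_neg (w : ℂ)).cexp).comp_ofReal).congr_deriv ?_
  rw [Complex.cpow_sub _ _ hw', Complex.cpow_one]
  field_simp
  ring

/-- The derivative of `Γ(a, ·)` at `w > 0` is `-w ^ (a - 1) * exp (-w)`. -/
theorem hasDerivAt_incGamma (a : ℂ) {w : ℝ} (hw : 0 < w) :
    HasDerivAt
      (fun w : ℝ => ∫ t in Ioi w, (t : ℂ) ^ (a - 1) * Complex.exp (-(t : ℂ)))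
      (-((w : ℂ) ^ (a - 1) * Complex.exp (-(w : ℂ)))) w := by
  have hcont := (contDiffOn_incGamma_integrand a).continuousOn
  have hftc := intervalIntegral.integral_hasDerivAt_right
    (f := fun t : ℝ => (t : ℂ) ^ (a - 1) * Complex.exp (-(t : ℂ))) (a := w) (b := w)
    IntervalIntegrable.refl (hcont.stronglyMeasurableAtFilter isOpen_Ioi w hw)
    (hcont.continuousAt (Ioi_mem_nhds hw))
  refine (hftc.const_sub
    (∫ t in Ioi w, (t : ℂ) ^ (a - 1) * Complex.exp (-(t : ℂ)))).congr_of_eventuallyEq ?_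
  filter_upwards [Ioi_mem_nhds hw] with v hv
  rw [← intervalIntegral.integral_Ioi_sub_Ioi' (integrableOn_incGamma_integrand a hw)
    (integrableOn_incGamma_integrand a hv), sub_sub_cancel]

theorem contDiffOn_incGamma (a : ℂ) :
    ContDiffOn ℝ ∞
      (fun w : ℝ => ∫ t in Ioi w, (t : ℂ) ^ (a - 1) * Complex.exp (-(t : ℂ))) (Ioi 0) :=
  (contDiffOn_infty_iff_deriv_of_isOpen isOpen_Ioi).2
    ⟨fun _ hw => (hasDerivAt_incGamma a hw).differentiableAt.differentiableWithinAt,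
      (contDiffOn_incGamma_integrand a).neg.congr fun _ hw => (hasDerivAt_incGamma a hw).deriv⟩

theorem ContDiffOn.hasDerivAt_iteratedDeriv {f : ℝ → ℂ} {s : Set ℝ} (hf : ContDiffOn ℝ ∞ f s)
    (hs : IsOpen s) {w : ℝ} (hw : w ∈ s) (n : ℕ) :
    HasDerivAt (iteratedDeriv n f) (iteratedDeriv (n + 1) f w) w := by
  have hdiff := (hf.differentiableOn_iteratedDerivWithin (m := n)
    (mod_cast ENat.natCast_lt_top n) hs.uniqueDiffOn).congr
      fun v hv => (iteratedDerivWithin_of_isOpen hs hv).symm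
  rw [iteratedDeriv_succ]
  exact (hdiff.differentiableAt (hs.mem_nhds hw)).hasDerivAt

/-- The recurrence between successive derivatives of `Γ(a, ·)` on `(0, ∞)`. -/
theorem iteratedDeriv_incGamma_recurrence (a : ℂ) {G : ℝ → ℂ}
    (hG : G = fun w : ℝ => ∫ t in Ioi w, (t : ℂ) ^ (a - 1) * Complex.exp (-(t : ℂ)))
    (n : ℕ) {w : ℝ} (hw : 0 < w) :
    (w : ℂ) * iteratedDeriv (n + 2) G w + (n + 1 + w - a) * iteratedDeriv (n + 1) G w +
      n * iteratedDeriv n G w = 0 := by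
  induction n generalizing w with
  | zero =>
    have hderiv : EqOn (deriv G)
        (fun t : ℝ => -((t : ℂ) ^ (a - 1) * Complex.exp (-(t : ℂ)))) (Ioi 0) :=
      fun t ht => hG ▸ (hasDerivAt_incGamma a ht).deriv
    have hw' : (w : ℂ) ≠ 0 := Complex.ofReal_ne_zero.2 hw.ne'
    have hderiv₂ := (hderiv.eventuallyEq_of_mem (Ioi_mem_nhds hw)).deriv_eq.trans
      (hasDerivAt_incGamma_integrand a hw).neg.deriv
    rw [iteratedDeriv_succ, zero_add, iteratedDeriv_one, hderiv₂, hderiv hw]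
    push_cast
    field_simp
    ring
  | succ n ih =>
    have hsmooth : ContDiffOn ℝ ∞ G (Ioi 0) := hG ▸ contDiffOn_incGamma a
    have hD := hsmooth.hasDerivAt_iteratedDeriv isOpen_Ioi hw
    have hid : HasDerivAt (fun t : ℝ => (t : ℂ)) 1 w := (hasDerivAt_id (w : ℂ)).comp_ofReal
    have hsum := ((hid.mul (hD (n + 2))).add
      (((hid.const_add ((n : ℂ) + 1)).sub_const a).mul (hD (n + 1)))).add
        ((hD n).const_mul (n : ℂ))
    have hzero := hsum.unique ((hasDerivAt_const w (0 : ℂ)).congr_of_eventuallyEq <| by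
      filter_upwards [Ioi_mem_nhds hw] with t ht using ih ht)
    push_cast
    linear_combination hzero


/-- for complex `a` and real `u > 0`, the Taylor coefficients
`c_n(u) = (1/n!) (d/du)^n Γ(a,u)` of the incomplete gamma function
`Γ(a,u) = ∫_u^∞ t^(a-1) e^(-t) dt` satisfy the second-order recurrence
`u (n+1)(n+2) c_{n+2}(u) + (n+1)(n+1+u-a) c_{n+1}(u) + n c_n(u) = 0` for all `n ≥ 0`. -/
theorem incGamma_taylor_recurrence (a : ℂ) (u : ℝ) (hu : 0 < u) (c : ℕ → ℂ)
    (hc : ∀ n : ℕ, c n = (1 / (n.factorial : ℂ)) *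
      iteratedDeriv n
        (fun w : ℝ => ∫ t in Set.Ioi w, (t : ℂ) ^ (a - 1) * Complex.exp (-(t : ℂ))) u) :
    ∀ n : ℕ,
      (u : ℂ) * ((n : ℂ) + 1) * ((n : ℂ) + 2) * c (n + 2) +
          ((n : ℂ) + 1) * ((n : ℂ) + 1 + u - a) * c (n + 1) + (n : ℂ) * c n = 0 := by
  intro n
  have hrec := iteratedDeriv_incGamma_recurrence a rfl n hu
  have hfact : (n.factorial : ℂ) ≠ 0 := Nat.cast_ne_zero.2 n.factorial_ne_zero
  have hn₁ : (n : ℂ) + 1 ≠ 0 := Nat.cast_add_one_ne_zero n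
  have hn₂ : (n : ℂ) + 2 ≠ 0 := mod_cast (n + 1).succ_ne_zero
  have hfact₁ : ((n + 1).factorial : ℂ) = (n + 1) * n.factorial := by
    rw [Nat.factorial_succ]
    push_cast
    ring
  have hfact₂ : ((n + 2).factorial : ℂ) = (n + 2) * ((n + 1) * n.factorial) := by
    rw [Nat.factorial_succ, Nat.cast_mul, hfact₁]
    push_cast
    ring
  rw [hc n, hc (n + 1), hc (n + 2), hfact₁, hfact₂]
  field_simp
  linear_combination hrec
end

section
/- The Riemann zeta function satisfies ζ(3) = (5/2) · ∑_{n=1}^∞ (−1)^(n+1) (n!)² / (n³ (2n)!). -/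
open Filter Topology Finset

/-- The remainder kernel `k!² (n - k)! / (2 k³ (n + k)!)` evaluated at `k + 1`. -/
noncomputable def aperyKernel (n k : ℕ) : ℝ :=
  ((k + 1).factorial : ℝ) ^ 2 * ((n - (k + 1)).factorial : ℝ) /
    (2 * ((k : ℝ) + 1) ^ 3 * ((n + (k + 1)).factorial : ℝ))

/-- The general term `(-1)^(n+1) (n!)² / (n³ (2n)!)` evaluated at `n = k + 1`. -/
noncomputable def aperyTerm (k : ℕ) : ℝ :=
  (-1) ^ (k + 2) * ((k + 1).factorial : ℝ) ^ 2 /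
    (((k : ℝ) + 1) ^ 3 * ((2 * (k + 1)).factorial : ℝ))

lemma sum_aperyKernel_sub (N K : ℕ) (hK : K ≤ N) :
    ∑ k ∈ range K, (-1) ^ (k + 1) * (aperyKernel (N + 1) k - aperyKernel N k) =
      1 / ((N : ℝ) + 1) ^ 3 - (-1) ^ K * (K.factorial : ℝ) ^ 2 * ((N - K).factorial : ℝ) /
        (((N : ℝ) + 1) ^ 2 * ((N + 1 + K).factorial : ℝ)) := by
  induction K with
  | zero =>
    have := N.factorial_ne_zero
    simp only [range_zero, sum_empty, pow_zero, Nat.factorial_zero, Nat.sub_zero, add_zero,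
      Nat.factorial_succ]
    push_cast
    field_simp
    ring
  | succ K ih =>
    rw [sum_range_succ, ih (by omega)]
    obtain ⟨m, rfl⟩ := Nat.exists_eq_add_of_le hK
    have h₁ : K + 1 + m + 1 - (K + 1) = m + 1 := by omega
    have h₂ : K + 1 + m - (K + 1) = m := by omega
    have h₃ : K + 1 + m - K = m + 1 := by omega
    have h₄ : K + 1 + m + 1 + (K + 1) = (2 * K + m + 2) + 1 := by omega
    have h₅ : K + 1 + m + (K + 1) = 2 * K + m + 2 := by omega
    have h₆ : K + 1 + m + 1 + K = 2 * K + m + 2 := by omega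
    have := (2 * K + m + 2).factorial_ne_zero
    simp only [aperyKernel, h₁, h₂, h₃, h₄, h₅, h₆, Nat.factorial_succ K, Nat.factorial_succ m,
      Nat.factorial_succ (2 * K + m + 2), pow_succ (-1 : ℝ) K]
    push_cast
    field_simp
    ring

lemma sum_one_div_cube_eq (N : ℕ) :
    ∑ k ∈ range N, 1 / ((k : ℝ) + 1) ^ 3 =
      5 / 2 * ∑ k ∈ range N, aperyTerm k +
        ∑ k ∈ range N, (-1) ^ (k + 1) * aperyKernel N k := by
  induction N with
  | zero => simp
  | succ N ih =>
    have h := sum_aperyKernel_sub N N le_rfl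
    simp only [mul_sub, sum_sub_distrib] at h
    rw [sum_range_succ, sum_range_succ aperyTerm,
      sum_range_succ (fun k ↦ (-1) ^ (k + 1) * aperyKernel (N + 1) k), ih]
    have key : (1 : ℝ) / ((N : ℝ) + 1) ^ 3 = 5 / 2 * aperyTerm N +
        (1 / ((N : ℝ) + 1) ^ 3 - (-1) ^ N * (N.factorial : ℝ) ^ 2 * ((N - N).factorial : ℝ) /
          (((N : ℝ) + 1) ^ 2 * ((N + 1 + N).factorial : ℝ))) +
        (-1) ^ (N + 1) * aperyKernel (N + 1) N := by
      have h₁ : 2 * (N + 1) = (2 * N + 1) + 1 := by omega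
      have h₂ : N + 1 + (N + 1) = (2 * N + 1) + 1 := by omega
      have h₃ : N + 1 + N = 2 * N + 1 := by omega
      have := (2 * N + 1).factorial_ne_zero
      simp only [aperyKernel, aperyTerm, h₁, h₂, h₃, Nat.sub_self, Nat.factorial_zero,
        Nat.factorial_succ N, Nat.factorial_succ (2 * N + 1), pow_succ (-1 : ℝ)]
      push_cast
      field_simp
      ring
    linarith

lemma aperyKernel_nonneg (n k : ℕ) : 0 ≤ aperyKernel n k := by
  unfold aperyKernel
  positivity

lemma aperyKernel_le {n k : ℕ} (hk : k < n) :
    aperyKernel n k ≤ 1 / ((n : ℝ) * ((n : ℝ) + 1)) := by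
  obtain ⟨m, rfl⟩ := Nat.exists_eq_add_of_lt hk
  have h₁ : k + m + 1 - (k + 1) = m := by omega
  -- `(k + 1) * choose n (k + 1) = n * choose (n - 1) k ≥ n`
  have h₂ : (k + m + 1) * ((k + 1).factorial * m.factorial) ≤
      (k + 1) * (k + m + 1).factorial := by
    have := Nat.le_of_dvd (Nat.factorial_pos _) (Nat.factorial_mul_factorial_dvd_factorial_add k m)
    rw [Nat.factorial_succ (k + m), Nat.factorial_succ k]
    calc _ = (k + 1) * ((k + m + 1) * (k.factorial * m.factorial)) := by ring
      _ ≤ _ := by gcongr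
  have h₃ : (k + m + 2) * ((k + 1).factorial * (k + m + 1).factorial) ≤
      (k + 1) * (k + m + 1 + (k + 1)).factorial := by
    have := Nat.le_of_dvd (Nat.factorial_pos _)
      (Nat.factorial_mul_factorial_dvd_factorial_add k (k + m + 2))
    rw [Nat.factorial_succ (k + m + 1), show k + (k + m + 2) = k + m + 1 + (k + 1) by ring] at this
    rw [Nat.factorial_succ k]
    calc _ = (k + 1) * (k.factorial * ((k + m + 1 + 1) * (k + m + 1).factorial)) := by ring
      _ ≤ _ := by gcongr
  have h₄ : (k + m + 1) * (k + m + 2) * ((k + 1).factorial ^ 2 * m.factorial) ≤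
      (k + 1) ^ 2 * (k + m + 1 + (k + 1)).factorial := by
    refine Nat.le_of_mul_le_mul_right ?_ (k + m + 1).factorial_pos
    calc _ = ((k + m + 1) * ((k + 1).factorial * m.factorial)) *
          ((k + m + 2) * ((k + 1).factorial * (k + m + 1).factorial)) := by ring
      _ ≤ _ := Nat.mul_le_mul h₂ h₃
      _ = _ := by ring
  have h₅ : (k + m + 1) * (k + m + 2) * ((k + 1).factorial ^ 2 * m.factorial) ≤
      2 * (k + 1) ^ 3 * (k + m + 1 + (k + 1)).factorial := by
    refine h₄.trans (Nat.mul_le_mul_right _ ?_)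
    nlinarith [sq_nonneg (k + 1), Nat.zero_le (k * (k + 1) ^ 2)]
  have h₆ := (Nat.cast_le (α := ℝ)).2 h₅
  push_cast at h₆
  rw [aperyKernel, h₁, div_le_div_iff₀ (by positivity) (by positivity)]
  push_cast
  linarith

lemma tendsto_sum_aperyKernel :
    Tendsto (fun N : ℕ ↦ ∑ k ∈ range N, (-1) ^ (k + 1) * aperyKernel N k) atTop (𝓝 0) := by
  refine squeeze_zero_norm (fun N ↦ ?_) tendsto_one_div_add_atTop_nhds_zero_nat
  calc ‖∑ k ∈ range N, (-1) ^ (k + 1) * aperyKernel N k‖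
      ≤ ∑ k ∈ range N, 1 / ((N : ℝ) * ((N : ℝ) + 1)) := by
        refine norm_sum_le_of_le _ fun k hk ↦ ?_
        rw [norm_mul, norm_pow, norm_neg, norm_one, one_pow, one_mul,
          Real.norm_of_nonneg (aperyKernel_nonneg N k)]
        exact aperyKernel_le (mem_range.1 hk)
    _ ≤ 1 / ((N : ℝ) + 1) := by
        rw [sum_const, card_range, nsmul_eq_mul]
        rcases Nat.eq_zero_or_pos N with rfl | hN
        · simp
        · field_simp
          exact le_rfl

lemma summable_one_div_add_one_cube : Summable fun k : ℕ ↦ 1 / ((k : ℝ) + 1) ^ 3 := by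
  simpa using (summable_nat_add_iff 1).2 (Real.summable_one_div_nat_pow.2 (by norm_num : 1 < 3))

lemma summable_aperyTerm : Summable aperyTerm := by
  refine Summable.of_norm_bounded summable_one_div_add_one_cube fun k ↦ ?_
  have h : ((k + 1).factorial : ℝ) ^ 2 ≤ ((2 * (k + 1)).factorial : ℝ) := by
    have := Nat.le_of_dvd (Nat.factorial_pos _)
      (Nat.factorial_mul_factorial_dvd_factorial_add (k + 1) (k + 1))
    rw [← sq, ← two_mul] at this
    exact_mod_cast this
  have hk : (0 : ℝ) < (k : ℝ) + 1 := by positivity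
  rw [aperyTerm, norm_div, norm_mul, norm_pow, norm_neg, norm_one, one_pow, one_mul,
    Real.norm_of_nonneg (by positivity), Real.norm_of_nonneg (by positivity),
    div_le_div_iff₀ (by positivity) (by positivity), one_mul, mul_comm]
  gcongr

lemma tsum_one_div_add_one_cube :
    ∑' k : ℕ, 1 / ((k : ℝ) + 1) ^ 3 = 5 / 2 * ∑' k, aperyTerm k := by
  refine tendsto_nhds_unique summable_one_div_add_one_cube.hasSum.tendsto_sum_nat ?_
  simpa only [sum_one_div_cube_eq, add_zero] using
    (summable_aperyTerm.hasSum.tendsto_sum_nat.const_mul (5 / 2)).add tendsto_sum_aperyKernel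

/-- `ζ(3) = (5/2) ∑_{n=1}^∞ (-1)^(n+1) (n!)² / (n³ (2n)!)`
(the sum is indexed by `n = k + 1`, `k ≥ 0`). -/
theorem zeta_three_series :
    riemannZeta 3 = (5 / 2) * ∑' k : ℕ,
      (-1) ^ (k + 2) * ((k + 1).factorial : ℂ) ^ 2 /
        (((k : ℂ) + 1) ^ 3 * ((2 * (k + 1)).factorial : ℂ)) := by
  have h := congrArg Complex.ofReal tsum_one_div_add_one_cube
  simp only [aperyTerm, Complex.ofReal_mul, Complex.ofReal_tsum] at h
  push_cast at h
  rw [← h, zeta_eq_tsum_one_div_nat_add_one_cpow (by norm_num)]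
  exact tsum_congr fun k ↦ by norm_cast
end

section
/- The Euler–Mascheroni constant satisfies γ = log(4π) − 2 + (2/√π) ∑_{n=1}^∞ (1/n) Γ(1/2, π n²) + 2 ∑_{n=1}^∞ Γ(0, π n²), where both series converge. -/
/-- The real (upper) incomplete gamma function `Γ(a,x) = ∫_x^∞ t^(a-1) e^(-t) dt`
for real `a` and real `x`. -/
noncomputable def realIncGamma (a : ℝ) (x : ℝ) : ℝ :=
  ∫ t in Set.Ioi x, t ^ (a - 1) * Real.exp (-t)

section

open MeasureTheory Set HurwitzZeta

lemma integral_rpow_mul_exp_Ioi_one (a : ℝ) {c : ℝ} (hc : 0 < c) :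
    ∫ x in Ioi (1 : ℝ), x ^ (a - 1) * Real.exp (-(c * x)) = c ^ (-a) * realIncGamma a c := by
  have h := integral_comp_mul_left_Ioi (fun t : ℝ => t ^ (a - 1) * Real.exp (-t)) 1 hc
  rw [mul_one] at h
  have h2 : ∫ x in Ioi (1 : ℝ), x ^ (a - 1) * Real.exp (-(c * x)) =
      c ^ (1 - a) * ∫ x in Ioi (1 : ℝ), (c * x) ^ (a - 1) * Real.exp (-(c * x)) := by
    rw [← integral_const_mul]
    refine setIntegral_congr_fun measurableSet_Ioi fun x hx => ?_
    have hx0 : (0 : ℝ) < x := one_pos.trans hx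
    have hc1 : c ^ (1 - a) * c ^ (a - 1) = 1 := by
      rw [← Real.rpow_add hc]; simp
    simp only [Real.mul_rpow hc.le hx0.le]
    linear_combination -(x ^ (a - 1) * Real.exp (-(c * x))) * hc1
  rw [h2, h, realIncGamma, smul_eq_mul, ← mul_assoc, sub_eq_neg_add, Real.rpow_add hc,
    Real.rpow_one, mul_assoc (c ^ (-a)), mul_inv_cancel₀ hc.ne', mul_one]

lemma rpow_mul_exp_le_exp {a : ℝ} (ha : a ≤ 1) (c : ℝ) {x : ℝ} (hx : x ∈ Ioi (1 : ℝ)) :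
    x ^ (a - 1) * Real.exp (-(c * x)) ≤ Real.exp (-c * x) := by
  rw [neg_mul]
  exact mul_le_of_le_one_left (Real.exp_pos _).le
    (Real.rpow_le_one_of_one_le_of_nonpos (le_of_lt hx) (by linarith))

lemma integrableOn_rpow_mul_exp_Ioi_one {a : ℝ} (ha : a ≤ 1) {c : ℝ} (hc : 0 < c) :
    IntegrableOn (fun x : ℝ => x ^ (a - 1) * Real.exp (-(c * x))) (Ioi 1) := by
  refine (integrableOn_exp_mul_Ioi (neg_lt_zero.mpr hc) 1).mono' ?_ ?_
  · refine ContinuousOn.aestronglyMeasurable (fun x hx => ?_) measurableSet_Ioi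
    have hx0 : x ≠ 0 := (one_pos.trans hx).ne'
    exact ((Real.continuousAt_rpow_const x (a - 1) (Or.inl hx0)).mul
      (by fun_prop)).continuousWithinAt
  · refine (ae_restrict_iff' measurableSet_Ioi).mpr (Filter.Eventually.of_forall fun x hx => ?_)
    have hx0 : (0 : ℝ) < x := one_pos.trans hx
    rw [Real.norm_of_nonneg (by positivity)]
    exact rpow_mul_exp_le_exp ha c hx

lemma integral_rpow_mul_exp_Ioi_one_le {a : ℝ} (ha : a ≤ 1) {c : ℝ} (hc : 0 < c) :
    ∫ x in Ioi (1 : ℝ), x ^ (a - 1) * Real.exp (-(c * x)) ≤ 1 / c := by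
  calc _ ≤ ∫ x in Ioi (1 : ℝ), Real.exp (-c * x) :=
        setIntegral_mono_on (integrableOn_rpow_mul_exp_Ioi_one ha hc)
          (integrableOn_exp_mul_Ioi (neg_lt_zero.mpr hc) 1) measurableSet_Ioi
          fun x hx => rpow_mul_exp_le_exp ha c hx
    _ = Real.exp (-c) / c := by
        rw [integral_exp_mul_Ioi (neg_lt_zero.mpr hc), mul_one, neg_div_neg_eq]
    _ ≤ 1 / c := by
        gcongr
        exact Real.exp_le_one_iff.mpr (by linarith)

/-- Termwise integration of the theta series over `(1, ∞)`. -/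
lemma hasSum_integral_evenKernel_sub_one {a : ℝ} (ha : a ≤ 1) :
    HasSum (fun k : ℕ => 2 * ((Real.pi * ((k : ℝ) + 1) ^ 2) ^ (-a) *
        realIncGamma a (Real.pi * ((k : ℝ) + 1) ^ 2)))
      (∫ x in Ioi (1 : ℝ), x ^ (a - 1) * (evenKernel 0 x - 1)) := by
  have hc (k : ℕ) : 0 < Real.pi * ((k : ℝ) + 1) ^ 2 := by positivity
  have hsum : Summable fun k : ℕ => ∫ x in Ioi (1 : ℝ),
      ‖2 * (x ^ (a - 1) * Real.exp (-(Real.pi * ((k : ℝ) + 1) ^ 2 * x)))‖ := by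
    have hsq : Summable fun k : ℕ => 2 * (1 / (Real.pi * ((k : ℝ) + 1) ^ 2)) := by
      have h := (summable_nat_add_iff 1).mpr (Real.summable_one_div_nat_pow.mpr one_lt_two)
      refine (h.mul_left (2 / Real.pi)).congr fun k => ?_
      push_cast
      field_simp
    refine hsq.of_nonneg_of_le (fun k => integral_nonneg fun x => norm_nonneg _) fun k => ?_
    rw [setIntegral_congr_fun measurableSet_Ioi (g := fun x : ℝ =>
      2 * (x ^ (a - 1) * Real.exp (-(Real.pi * ((k : ℝ) + 1) ^ 2 * x)))), integral_const_mul]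
    · exact mul_le_mul_of_nonneg_left (integral_rpow_mul_exp_Ioi_one_le ha (hc k)) zero_le_two
    · intro x hx
      have hx0 : (0 : ℝ) < x := one_pos.trans hx
      exact Real.norm_of_nonneg (by positivity)
  have h := hasSum_integral_of_summable_integral_norm (μ := volume.restrict (Ioi (1 : ℝ)))
    (fun k : ℕ => (integrableOn_rpow_mul_exp_Ioi_one ha (hc k)).const_mul 2) hsum
  simp_rw [integral_const_mul, integral_rpow_mul_exp_Ioi_one a (hc _)] at h
  have hθ : EqOn (fun x : ℝ => ∑' k : ℕ,
      2 * (x ^ (a - 1) * Real.exp (-(Real.pi * ((k : ℝ) + 1) ^ 2 * x))))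
      (fun x => x ^ (a - 1) * (evenKernel 0 x - 1)) (Ioi 1) := by
    intro x hx
    have hx' := (hasSum_nat_cosKernel₀ 0 (one_pos.trans hx)).mul_left (x ^ (a - 1))
    simp only [AddCircle.coe_zero, ← evenKernel_eq_cosKernel_of_zero] at hx'
    simp only [← hx'.tsum_eq]
    refine tsum_congr fun k => ?_
    simp only [mul_zero, zero_mul, Real.cos_zero, neg_mul]
    ring
  rwa [setIntegral_congr_fun measurableSet_Ioi hθ] at h

/-- The completed zeta value at `1` as an integral over `(1, ∞)`, by the theta functional
equation. -/
lemma two_mul_completedRiemannZeta₀_one :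
    2 * completedRiemannZeta₀ 1 =
      ((∫ x in Ioi (1 : ℝ), x ^ ((1 / 2 : ℝ) - 1) * (evenKernel 0 x - 1)) +
        ∫ x in Ioi (1 : ℝ), x ^ ((0 : ℝ) - 1) * (evenKernel 0 x - 1) : ℝ) := by
  set P := hurwitzEvenFEPair 0 with hP
  set F : ℝ → ℂ := fun x => (x : ℂ) ^ ((1 / 2 : ℂ) - 1) • P.f_modif x with hF
  have hint : IntegrableOn F (Ioi 0) := (P.isStrongFEPair_toStrongFEPair.hasMellin (1 / 2)).1
  have hone {x : ℝ} (hx : 1 < x) : P.f_modif x = ((evenKernel 0 x - 1 : ℝ) : ℂ) := by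
    simp [WeakFEPair.f_modif, hx, hx.le, hP, hurwitzEvenFEPair]
  have hsymm {x : ℝ} (hx : 0 < x) :
      P.f_modif x⁻¹ = ((x ^ (1 / 2 : ℝ) : ℝ) : ℂ) * P.f_modif x := by
    have h := P.hf_modif_FE x hx
    have hg : P.g_modif = P.f_modif := by
      change P.symm.f_modif = P.f_modif
      rw [hP, hurwitzEvenFEPair_zero_symm]
    rw [hg, one_div] at h
    simpa [hP, hurwitzEvenFEPair] using h
  have hpow {x : ℝ} (hx : 0 < x) :
      (x : ℂ) ^ ((1 / 2 : ℂ) - 1) = ((x ^ ((1 / 2 : ℝ) - 1) : ℝ) : ℂ) := by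
    rw [Complex.ofReal_cpow hx.le]; push_cast; rfl
  have hsplit : ∫ x in Ioi 0, F x = (∫ x in Ioi 1, F x) + ∫ x in Ioc 0 1, F x := by
    rw [← Ioc_union_Ioi_eq_Ioi zero_le_one, setIntegral_union Ioc_disjoint_Ioi_same
      measurableSet_Ioi (hint.mono_set Ioc_subset_Ioi_self)
      (hint.mono_set (Ioi_subset_Ioi zero_le_one)), add_comm]
  have hlow : ∫ x in Ioc 0 1, F x =
      ∫ x in Ioi (1 : ℝ), ((x ^ ((0 : ℝ) - 1) * (evenKernel 0 x - 1) : ℝ) : ℂ) := by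
    have h1 : ∫ x in Ioc 0 1, F x = ∫ x in Ioi 0, (Ioo 0 1).indicator F x := by
      rw [setIntegral_indicator measurableSet_Ioo, inter_eq_right.mpr Ioo_subset_Ioi_self,
        integral_Ioc_eq_integral_Ioo]
    rw [h1, ← integral_comp_rpow_Ioi _ (neg_ne_zero.mpr one_ne_zero),
      ← inter_eq_right.mpr (Ioi_subset_Ioi (zero_le_one (α := ℝ))),
      ← setIntegral_indicator measurableSet_Ioi]
    refine setIntegral_congr_fun measurableSet_Ioi fun x (hx : 0 < x) => ?_
    simp only [Real.rpow_neg_one]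
    by_cases hx1 : 1 < x
    · rw [indicator_of_mem (mem_Ioi.mpr hx1),
        indicator_of_mem (mem_Ioo.mpr ⟨inv_pos.mpr hx, inv_lt_one_of_one_lt₀ hx1⟩)]
      simp only [hF]
      rw [hpow (inv_pos.mpr hx), hsymm hx, hone hx1, smul_eq_mul, Complex.real_smul]
      simp only [← Complex.ofReal_mul]
      rw [← mul_assoc, ← mul_assoc, Real.inv_rpow hx.le, ← Real.rpow_neg hx.le, abs_neg, abs_one,
        one_mul, ← Real.rpow_add hx, ← Real.rpow_add hx]
      norm_num
    · rw [indicator_of_notMem (fun h : x⁻¹ ∈ Ioo 0 1 => hx1 ((inv_lt_one₀ hx).mp h.2)),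
        indicator_of_notMem (show x ∉ Ioi 1 from hx1), smul_zero]
  have hhigh : ∫ x in Ioi 1, F x =
      ∫ x in Ioi (1 : ℝ), ((x ^ ((1 / 2 : ℝ) - 1) * (evenKernel 0 x - 1) : ℝ) : ℂ) := by
    refine setIntegral_congr_fun measurableSet_Ioi fun x hx => ?_
    simp only [hF]
    rw [hpow (one_pos.trans hx), hone hx, smul_eq_mul, Complex.ofReal_mul]
  have hzeta : 2 * completedRiemannZeta₀ 1 = ∫ x in Ioi 0, F x := by
    change 2 * (mellin P.f_modif (1 / 2) / 2) = mellin P.f_modif (1 / 2)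
    ring
  rw [hzeta, hsplit, hlow, hhigh, integral_complex_ofReal, integral_complex_ofReal, Complex.ofReal_add]

end

/-- Coffey's formula for the Euler–Mascheroni constant,
`γ = log(4π) - 2 + (2/√π) ∑_{n=1}^∞ (1/n) Γ(1/2, πn²) + 2 ∑_{n=1}^∞ Γ(0, πn²)`,
where both series converge (sums indexed by `n = k + 1`, `k ≥ 0`). -/
theorem eulerMascheroni_incGamma_series :
    Summable (fun k : ℕ => (1 / ((k : ℝ) + 1)) *
      realIncGamma (1 / 2) (Real.pi * ((k : ℝ) + 1) ^ 2)) ∧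
    Summable (fun k : ℕ => realIncGamma 0 (Real.pi * ((k : ℝ) + 1) ^ 2)) ∧
    Real.eulerMascheroniConstant = Real.log (4 * Real.pi) - 2 +
      (2 / Real.sqrt Real.pi) *
        (∑' k : ℕ, (1 / ((k : ℝ) + 1)) * realIncGamma (1 / 2) (Real.pi * ((k : ℝ) + 1) ^ 2)) +
      2 * ∑' k : ℕ, realIncGamma 0 (Real.pi * ((k : ℝ) + 1) ^ 2) := by
  have h₁ := hasSum_integral_evenKernel_sub_one (a := 1 / 2) (by norm_num)
  have h₀ := hasSum_integral_evenKernel_sub_one (a := 0) zero_le_one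
  have hcoeff (k : ℕ) : 2 * ((Real.pi * ((k : ℝ) + 1) ^ 2) ^ (-(1 / 2) : ℝ) *
      realIncGamma (1 / 2) (Real.pi * ((k : ℝ) + 1) ^ 2)) =
      2 / Real.sqrt Real.pi * (1 / ((k : ℝ) + 1) *
        realIncGamma (1 / 2) (Real.pi * ((k : ℝ) + 1) ^ 2)) := by
    rw [Real.rpow_neg (by positivity), ← Real.sqrt_eq_rpow, Real.sqrt_mul Real.pi_pos.le,
      Real.sqrt_sq (by positivity)]
    field_simp
  simp_rw [hcoeff] at h₁
  simp only [neg_zero, Real.rpow_zero, one_mul] at h₀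
  have hpi : (2 / Real.sqrt Real.pi : ℝ) ≠ 0 := by positivity
  refine ⟨(summable_mul_left_iff hpi).mp h₁.summable,
    (summable_mul_left_iff two_ne_zero).mp h₀.summable, ?_⟩
  rw [← tsum_mul_left, ← tsum_mul_left, h₁.tsum_eq, h₀.tsum_eq, add_assoc]
  have hγ : 2 * completedRiemannZeta₀ 1 =
      ((Real.eulerMascheroniConstant - Real.log (4 * Real.pi) + 2 : ℝ) : ℂ) := by
    rw [completedRiemannZeta₀_one]
    push_cast [Complex.ofReal_log (show 0 ≤ 4 * Real.pi by positivity)]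
    ring
  linarith [Complex.ofReal_injective (hγ.symm.trans two_mul_completedRiemannZeta₀_one)]
end

section
/- Let α, β > 0 be real numbers with αβ = 4π³. Then ∑_{n=1}^∞ 1/(e^(n²α) − 1) = π²/(6α) + 1/4 + (√β/(4π)) · [ ζ(1/2) + ∑_{n=1}^∞ ( cos(√(nβ)) − sin(√(nβ)) − e^(−√(nβ)) ) / ( √n · ( cosh(√(nβ)) − cos(√(nβ)) ) ) ], and both series converge. -/
section
open Filter Topology

theorem norm_cpow_euler_maclaurin_term_le {x : ℝ} (hx : 0 < x) {s : ℂ} (hs : 0 < s.re) :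
    ‖(s - 1) * (x : ℂ) ^ (-s) + (((x + 1 : ℝ) : ℂ) ^ (1 - s) - (x : ℂ) ^ (1 - s))‖ ≤
      ‖s - 1‖ * ‖s‖ * x ^ (-s.re - 1) := by
  have hder (c : ℂ) (hc : c ≠ 0) {t : ℝ} (ht : x ≤ t) :
      HasDerivAt (fun y : ℝ => (y : ℂ) ^ c) (c * (t : ℂ) ^ (c - 1)) t :=
    hasDerivAt_ofReal_cpow_const (hx.trans_le ht).ne' hc
  have hs0 : s ≠ 0 := by rintro rfl; simp at hs
  rcases eq_or_ne s 1 with rfl | hs1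
  · simp
  have hdiff : ∀ t ∈ Set.Icc x (x + 1), ‖(t : ℂ) ^ (-s) - (x : ℂ) ^ (-s)‖ ≤
      ‖s‖ * x ^ (-s.re - 1) := by
    intro t ht
    refine (norm_image_sub_le_of_norm_deriv_le_segment'
      (fun y hy => (hder (-s) (neg_ne_zero.2 hs0) hy.1).hasDerivWithinAt)
      (C := ‖s‖ * x ^ (-s.re - 1)) ?_ t ht).trans ?_
    · intro y hy
      rw [norm_mul, norm_neg, Complex.norm_cpow_eq_rpow_re_of_pos (hx.trans_le hy.1)]
      simp only [Complex.sub_re, Complex.neg_re, Complex.one_re]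
      gcongr ?_ * ?_
      exact Real.rpow_le_rpow_of_nonpos hx hy.1 (by linarith)
    · exact mul_le_of_le_one_right (by positivity) (by linarith [ht.2])
  have := norm_image_sub_le_of_norm_deriv_le_segment' (a := x) (b := x + 1)
      (f := fun y : ℝ => (y : ℂ) ^ (1 - s) - (1 - s) * (x : ℂ) ^ (-s) * y)
      (f' := fun y : ℝ => (1 - s) * ((y : ℂ) ^ (-s) - (x : ℂ) ^ (-s)))
      (C := ‖s - 1‖ * ‖s‖ * x ^ (-s.re - 1)) ?_ ?_ (x + 1) (by simp)
  · refine le_trans (le_of_eq ?_) (this.trans (by simp))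
    congr 1
    push_cast
    ring
  · intro y hy
    have h1 := hder (1 - s) (sub_ne_zero.2 hs1.symm) hy.1
    have h2 : HasDerivAt (fun y : ℝ => (1 - s) * (x : ℂ) ^ (-s) * y)
        ((1 - s) * (x : ℂ) ^ (-s) * 1) y := (Complex.ofRealCLM.hasDerivAt).const_mul _
    convert! (h1.sub h2).hasDerivWithinAt using 1
    rw [show 1 - s - 1 = -s by ring]
    ring
  · intro y hy
    rw [norm_mul, norm_sub_rev, mul_assoc]
    gcongr
    exact hdiff y ⟨hy.1, hy.2.le⟩

theorem sum_range_cpow_euler_maclaurin_term (s : ℂ) (N : ℕ) :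
    ∑ n ∈ Finset.range N, ((s - 1) * ((n + 1 : ℝ) : ℂ) ^ (-s) +
      (((n + 1 + 1 : ℝ) : ℂ) ^ (1 - s) - ((n + 1 : ℝ) : ℂ) ^ (1 - s))) =
    (s - 1) * ∑ n ∈ Finset.range N, ((n + 1 : ℝ) : ℂ) ^ (-s) + (((N + 1 : ℝ) : ℂ) ^ (1 - s) - 1) := by
  rw [Finset.sum_add_distrib, Finset.mul_sum]
  congr 1
  simpa using Finset.sum_range_sub (fun n : ℕ => ((n + 1 : ℝ) : ℂ) ^ (1 - s)) N

theorem hasSum_cpow_euler_maclaurin_term {s : ℂ} (hs : 0 < s.re) :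
    HasSum (fun n : ℕ => (s - 1) * ((n + 1 : ℝ) : ℂ) ^ (-s) +
      (((n + 1 + 1 : ℝ) : ℂ) ^ (1 - s) - ((n + 1 : ℝ) : ℂ) ^ (1 - s))) (riemannZeta₁ s - 1) := by
  set T : ℕ → ℂ → ℂ := fun n s => (s - 1) * ((n + 1 : ℝ) : ℂ) ^ (-s) +
      (((n + 1 + 1 : ℝ) : ℂ) ^ (1 - s) - ((n + 1 : ℝ) : ℂ) ^ (1 - s)) with hT
  have hsumm {σ : ℝ} (hσ : 0 < σ) : Summable fun n : ℕ => ((n : ℝ) + 1) ^ (-σ - 1) := by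
    have := (summable_nat_add_iff 1).2 (Real.summable_nat_rpow (p := -σ - 1).2 (by linarith))
    simpa using this
  have hle (n : ℕ) {s : ℂ} (hs : 0 < s.re) : ‖T n s‖ ≤ ‖s - 1‖ * ‖s‖ * ((n : ℝ) + 1) ^ (-s.re - 1) :=
    norm_cpow_euler_maclaurin_term_le (by positivity) hs
  have hTs {s : ℂ} (hs : 0 < s.re) : Summable fun n => T n s :=
    .of_norm_bounded ((hsumm hs).mul_left _) fun n => hle n hs
  have hlarge {s : ℂ} (hs : 1 < s.re) : ∑' n, T n s = riemannZeta₁ s - 1 := by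
    have hs1 : s ≠ 1 := by rintro rfl; simp at hs
    have h1 := (hTs (s := s) (by linarith)).hasSum.tendsto_sum_nat
    refine tendsto_nhds_unique h1 ?_
    simp only [hT, sum_range_cpow_euler_maclaurin_term]
    have h2 : Tendsto (fun N : ℕ => ((N + 1 : ℝ) : ℂ) ^ (1 - s)) atTop (𝓝 0) := by
      rw [tendsto_zero_iff_norm_tendsto_zero]
      have : Tendsto (fun N : ℕ => ((N : ℝ) + 1) ^ (-(s.re - 1))) atTop (𝓝 0) :=
        (tendsto_rpow_neg_atTop (by linarith)).comp
          (tendsto_atTop_add_const_right _ _ tendsto_natCast_atTop_atTop)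
      refine this.congr fun N => ?_
      rw [Complex.norm_cpow_eq_rpow_re_of_pos (by positivity)]
      simp
    have h3 : HasSum (fun n : ℕ => ((n + 1 : ℝ) : ℂ) ^ (-s)) (riemannZeta s) := by
      rw [zeta_eq_tsum_one_div_nat_add_one_cpow hs]
      convert! ((summable_nat_add_iff 1).2 (Complex.summable_one_div_nat_cpow.2 hs)).hasSum using 1
      · ext n; simp [Complex.cpow_neg]
      · simp
    have h4 : riemannZeta₁ s - 1 = (s - 1) * riemannZeta s + (0 - 1) := by
      rw [riemannZeta_eq_inv_sub_mul hs1, mul_inv_cancel_left₀ (sub_ne_zero.2 hs1)]; ring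
    rw [h4]
    exact (h3.tendsto_sum_nat.const_mul _).add (h2.sub_const 1)
  set U : Set ℂ := {z | min s.re 1 / 2 < z.re} ∩ Metric.ball 0 (‖s‖ + 3)
  have hm : 0 < min s.re 1 := by positivity
  have hUo : IsOpen U := (isOpen_lt continuous_const Complex.continuous_re).inter Metric.isOpen_ball
  have hUc : IsPreconnected U := by
    refine (Convex.inter ?_ (convex_ball _ _)).isPreconnected
    exact convex_halfSpace_re_gt _
  have hsU : s ∈ U := ⟨by simp only [Set.mem_ofPred_eq]; linarith [min_le_left s.re 1], by simp⟩
  have h2U : (2 : ℂ) ∈ U := by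
    refine ⟨by simp only [Set.mem_ofPred_eq, Complex.re_ofNat]; linarith [min_le_right s.re 1], ?_⟩
    simp only [Metric.mem_ball, dist_zero_right, Complex.norm_ofNat]
    linarith [norm_nonneg s]
  have hd : DifferentiableOn ℂ (fun z => ∑' n, T n z) U := by
    refine Complex.differentiableOn_tsum_of_summable_norm
      (u := fun n : ℕ => (‖s‖ + 4) * (‖s‖ + 3) * ((n : ℝ) + 1) ^ (-(min s.re 1 / 2) - 1))
      ((hsumm (by positivity)).mul_left _) ?_ hUo ?_
    · intro n
      have h1 : ((n + 1 : ℝ) : ℂ) ≠ 0 := by norm_cast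
      have h2 : ((n + 1 + 1 : ℝ) : ℂ) ≠ 0 := by norm_cast
      refine Differentiable.differentiableOn ?_
      refine ((differentiable_id.sub_const 1).mul ?_).add (.sub ?_ ?_)
      · exact differentiable_id.neg.const_cpow (.inl h1)
      · exact (differentiable_id.const_sub 1).const_cpow (.inl h2)
      · exact (differentiable_id.const_sub 1).const_cpow (.inl h1)
    · intro n z hz
      have hzn : ‖z‖ ≤ ‖s‖ + 3 := by simpa using (Metric.mem_ball.1 hz.2).le
      have hz1 : min s.re 1 / 2 < z.re := hz.1
      refine (hle n (by linarith)).trans ?_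
      have : ‖z - 1‖ ≤ ‖s‖ + 4 := (norm_sub_le _ _).trans (by simp; linarith)
      gcongr
      linarith
  have hEq : Set.EqOn (fun z => ∑' n, T n z) (fun z => riemannZeta₁ z - 1) U := by
    refine (hd.analyticOnNhd hUo).eqOn_of_preconnected_of_eventuallyEq
      ((differentiable_riemannZeta₁.sub_const 1).differentiableOn.analyticOnNhd hUo) hUc h2U ?_
    filter_upwards [(isOpen_lt continuous_const Complex.continuous_re).mem_nhds
      (show (1 : ℝ) < (2 : ℂ).re by simp)] with z hz using hlarge hz
  rw [← show ∑' n, T n s = riemannZeta₁ s - 1 from hEq hsU]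
  exact (hTs hs).hasSum

theorem tendsto_sum_inv_sqrt_sub_two_mul_sqrt :
    Tendsto (fun N : ℕ => ((∑ k ∈ Finset.range N, 1 / √((k : ℝ) + 1) - 2 * √N : ℝ) : ℂ)) atTop
      (𝓝 (riemannZeta (1 / 2))) := by
  have h := (hasSum_cpow_euler_maclaurin_term (s := 1 / 2) (by norm_num)).tendsto_sum_nat
  simp only [sum_range_cpow_euler_maclaurin_term] at h
  have hd : Tendsto (fun N : ℕ => ((2 * (√((N : ℝ) + 1) - √N) : ℝ) : ℂ)) atTop (𝓝 0) := by
    rw [← Complex.ofReal_zero]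
    refine (Complex.continuous_ofReal.tendsto 0).comp ?_
    have h1 : Tendsto (fun N : ℕ => 2 * (√(N : ℝ))⁻¹) atTop (𝓝 0) := by
      simpa using ((tendsto_inv_atTop_zero.comp (Real.tendsto_sqrt_atTop.comp
        tendsto_natCast_atTop_atTop)).const_mul (2 : ℝ))
    refine squeeze_zero' (.of_forall fun N => ?_) ?_ h1
    · have := Real.sqrt_le_sqrt (show (N : ℝ) ≤ N + 1 by linarith)
      linarith
    · filter_upwards [eventually_gt_atTop 0] with N hN
      have hN' : 0 < √(N : ℝ) := by positivity
      gcongr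
      rw [← one_div, le_div_iff₀ hN']
      have h3 := Real.sq_sqrt (show (0 : ℝ) ≤ N by positivity)
      have h4 := Real.sq_sqrt (show (0 : ℝ) ≤ N + 1 by positivity)
      nlinarith [Real.sqrt_nonneg ((N : ℝ) + 1), Real.sqrt_le_sqrt (show (N : ℝ) ≤ N + 1 by linarith)]
  have hz : riemannZeta (1 / 2) = -2 * (riemannZeta₁ (1 / 2) - 1 + 1) + 0 := by
    rw [riemannZeta_eq_inv_sub_mul (by norm_num)]
    norm_num
  rw [hz]
  refine (((h.add_const 1).const_mul (-2)).add hd).congr fun N => ?_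
  have hc {x : ℝ} (hx : 0 < x) : (x : ℂ) ^ (-(1 / 2) : ℂ) = ((1 / √x : ℝ) : ℂ) := by
    rw [Real.sqrt_eq_rpow, one_div (x ^ _), ← Real.rpow_neg hx.le, Complex.ofReal_cpow hx.le]
    norm_num
  have hc' {x : ℝ} (hx : 0 < x) : (x : ℂ) ^ (1 - 1 / 2 : ℂ) = ((√x : ℝ) : ℂ) := by
    rw [Real.sqrt_eq_rpow, Complex.ofReal_cpow hx.le]
    norm_num
  have hsum : ∑ k ∈ Finset.range N, ((k + 1 : ℝ) : ℂ) ^ (-(1 / 2) : ℂ) =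
      ∑ k ∈ Finset.range N, ((1 / √((k : ℝ) + 1) : ℝ) : ℂ) :=
    Finset.sum_congr rfl fun k _ => hc (by positivity)
  rw [hc' (by positivity), hsum]
  push_cast
  ring

theorem hasSum_one_div_nat_sq_sub_sq {z : ℂ} (hz : z ∈ Complex.integerComplement) :
    HasSum (fun n : ℕ => 1 / (((n : ℂ) + 1) ^ 2 - z ^ 2))
      (1 / (2 * z ^ 2) - Real.pi * Complex.cot (Real.pi * z) / (2 * z)) := by
  have hz0 : z ≠ 0 := Complex.integerComplement.ne_zero hz
  have h := (summable_cotTerm hz).hasSum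
  have h' : ∑' n, cotTerm z n = Real.pi * Complex.cot (Real.pi * z) - 1 / z :=
    (cot_series_rep' hz).symm
  rw [h'] at h
  convert! h.mul_left (-1 / (2 * z)) using 1
  · ext n
    have h1 : z + (n + 1) ≠ 0 := by
      simpa using Complex.integerComplement_add_ne_zero hz (n + 1 : ℤ)
    have h2 : z - (n + 1) ≠ 0 := by
      simpa [sub_eq_add_neg] using Complex.integerComplement_add_ne_zero hz (-(n + 1) : ℤ)
    rw [cotTerm_identity hz, show ((n : ℂ) + 1) ^ 2 - z ^ 2 = -((z + (n + 1)) * (z - (n + 1))) by ring]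
    field_simp
  · field_simp
    ring

theorem mem_integerComplement_of_im_ne_zero {z : ℂ} (hz : z.im ≠ 0) :
    z ∈ Complex.integerComplement := by
  rintro ⟨n, rfl⟩
  simp at hz

theorem hasSum_inv_exp_sub_one_partial_fractions {x : ℝ} (hx : 0 < x) :
    HasSum (fun n : ℕ => 2 * x / (x ^ 2 + 4 * Real.pi ^ 2 * ((n : ℝ) + 1) ^ 2))
      (1 / (Real.exp x - 1) - 1 / x + 1 / 2) := by
  have hpi := Real.pi_pos
  set y : ℝ := x / (2 * Real.pi) with hy
  have hy0 : 0 < y := by positivity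
  have hxy : x = 2 * Real.pi * y := by rw [hy]; field_simp
  have h := hasSum_one_div_nat_sq_sub_sq (z := y * Complex.I)
    (mem_integerComplement_of_im_ne_zero (by simpa using hy0.ne'))
  have hexp : 2 * Real.pi * Complex.I * (y * Complex.I) = ((-x : ℝ) : ℂ) := by
    rw [hxy]; push_cast; linear_combination (2 * Real.pi * y : ℂ) * Complex.I_mul_I
  rw [Complex.cot_pi_eq_exp_ratio, hexp, ← Complex.ofReal_exp] at h
  have hq : Real.exp (-x) ≠ 1 := by simp [hx.ne']
  have hval : 1 / (2 * ((y : ℂ) * Complex.I) ^ 2) -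
      Real.pi * ((Real.exp (-x) + 1) / (Complex.I * (1 - Real.exp (-x)))) / (2 * (y * Complex.I)) =
      ((Real.pi * ((Real.exp (-x) + 1) / (1 - Real.exp (-x))) / (2 * y) - 1 / (2 * y ^ 2) : ℝ) : ℂ) := by
    have h1 : (1 - Real.exp (-x) : ℂ) ≠ 0 := by
      rw [sub_ne_zero]; exact_mod_cast hq.symm
    have h2 : (y : ℂ) ≠ 0 := by exact_mod_cast hy0.ne'
    push_cast at h1 ⊢
    field_simp
    rw [Complex.I_sq]
    ring
  rw [hval] at h
  have h' : HasSum (fun n : ℕ => 1 / (((n : ℝ) + 1) ^ 2 + y ^ 2))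
      (Real.pi * ((Real.exp (-x) + 1) / (1 - Real.exp (-x))) / (2 * y) - 1 / (2 * y ^ 2)) := by
    rw [← Complex.hasSum_ofReal]
    convert! h using 2 with n
    push_cast
    rw [mul_pow, Complex.I_sq]
    ring
  convert! h'.mul_left (x / (2 * Real.pi ^ 2)) using 1
  · ext n
    rw [hxy]
    field_simp
    ring
  · have h3 : Real.exp x - 1 ≠ 0 := (sub_pos.2 (Real.one_lt_exp_iff.2 hx)).ne'
    rw [Real.exp_neg]
    have h4 : 1 - (Real.exp x)⁻¹ ≠ 0 := by
      rw [sub_ne_zero, ne_comm, inv_ne_one]; exact sub_ne_zero.1 h3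
    rw [hxy] at *
    field_simp
    ring

theorem cosh_sub_cos_pos {w : ℝ} (hw : w ≠ 0) : 0 < Real.cosh w - Real.cos w := by
  linarith [Real.one_lt_cosh.2 hw, Real.cos_le_one w]

theorem hasSum_sq_div_pow_four_add {w : ℝ} (hw : 0 < w) :
    HasSum (fun n : ℕ => ((n : ℝ) + 1) ^ 2 / (((n : ℝ) + 1) ^ 4 + (w ^ 2 / (2 * Real.pi ^ 2)) ^ 2))
      (Real.pi ^ 2 / (2 * w) *
        ((Real.sinh w - Real.sin w) / (Real.cosh w - Real.cos w))) := by
  have hpi := Real.pi_pos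
  set y : ℝ := w / (2 * Real.pi) with hy
  have hy0 : 0 < y := by positivity
  have hwy : w = 2 * Real.pi * y := by rw [hy]; field_simp
  have h := hasSum_one_div_nat_sq_sub_sq (z := y * (1 - Complex.I))
    (mem_integerComplement_of_im_ne_zero (by simpa using hy0.ne'))
  have hexp : 2 * Real.pi * Complex.I * (y * (1 - Complex.I)) = w + w * Complex.I := by
    rw [hwy]; push_cast; linear_combination (-2 * Real.pi * y : ℂ) * Complex.I_mul_I
  rw [Complex.cot_pi_eq_exp_ratio, hexp] at h
  have hz2 : ((y : ℂ) * (1 - Complex.I)) ^ 2 = -((2 * y ^ 2 : ℝ) : ℂ) * Complex.I := by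
    push_cast; linear_combination (y ^ 2 : ℂ) * Complex.I_sq
  have h' := Complex.hasSum_re h
  convert! h' using 1
  · ext n
    rw [hz2, show (((n : ℂ) + 1) ^ 2 - -((2 * y ^ 2 : ℝ) : ℂ) * Complex.I) =
      ((((n : ℝ) + 1) ^ 2 : ℝ) : ℂ) + ((2 * y ^ 2 : ℝ) : ℂ) * Complex.I by push_cast; ring]
    rw [one_div, Complex.inv_re, Complex.normSq_add_mul_I]
    simp only [Complex.add_re, Complex.ofReal_re, Complex.re_ofReal_mul, Complex.I_re, mul_zero,
      add_zero]
    rw [hwy]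
    congr 1
    field_simp
  · have hE : Complex.exp (w + w * Complex.I) =
        ((Real.exp w * Real.cos w : ℝ) : ℂ) + ((Real.exp w * Real.sin w : ℝ) : ℂ) * Complex.I := by
      rw [Complex.exp_add, Complex.exp_mul_I]; push_cast; ring
    have hpos := cosh_sub_cos_pos hw.ne'
    have hden : 0 < (1 - Real.exp w * Real.cos w) ^ 2 + (Real.exp w * Real.sin w) ^ 2 := by
      have : (1 - Real.exp w * Real.cos w) ^ 2 + (Real.exp w * Real.sin w) ^ 2 =
          2 * Real.exp w * (Real.cosh w - Real.cos w) := by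
        rw [Real.cosh_eq, Real.exp_neg]
        field_simp
        linear_combination (Real.exp w) ^ 2 * Real.sin_sq_add_cos_sq w
      rw [this]; positivity
    have hE1 : (1 : ℂ) - (((Real.exp w * Real.cos w : ℝ) : ℂ) +
        ((Real.exp w * Real.sin w : ℝ) : ℂ) * Complex.I) =
        ((1 - Real.exp w * Real.cos w : ℝ) : ℂ) + ((-(Real.exp w * Real.sin w) : ℝ) : ℂ) * Complex.I := by
      push_cast; ring
    have hval : Real.pi * ((Complex.exp (w + w * Complex.I) + 1) /
        (Complex.I * (1 - Complex.exp (w + w * Complex.I)))) / (2 * (y * (1 - Complex.I))) =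
        ((Real.pi / (4 * y) : ℝ) : ℂ) * ((1 - Complex.I) * ((Complex.exp (w + w * Complex.I) + 1) *
        (1 - Complex.exp (w + w * Complex.I))⁻¹)) := by
      have : (1 - Complex.I) ≠ 0 := by
        intro h0; simpa using congrArg Complex.im h0
      have hI : (Complex.I * (1 - Complex.I))⁻¹ = (1 - Complex.I) / 2 := by
        rw [inv_eq_iff_eq_inv, inv_div, eq_div_iff this]
        linear_combination (-2 + Complex.I) * Complex.I_sq
      calc _ = (Real.pi / (2 * y)) * ((Complex.I * (1 - Complex.I))⁻¹ *
            ((Complex.exp (w + w * Complex.I) + 1) * (1 - Complex.exp (w + w * Complex.I))⁻¹)) := by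
            simp only [div_eq_mul_inv, mul_inv]; ring
        _ = _ := by rw [hI]; push_cast; ring
    rw [hval, hz2, hE, hE1, Complex.sub_re, Complex.re_ofReal_mul]
    have h0 : (1 / (2 * (-((2 * y ^ 2 : ℝ) : ℂ) * Complex.I))).re = 0 := by
      rw [show 2 * (-((2 * y ^ 2 : ℝ) : ℂ) * Complex.I) = ((-(4 * y ^ 2) : ℝ) : ℂ) * Complex.I by
        push_cast; ring, one_div, mul_inv, ← Complex.ofReal_inv, Complex.re_ofReal_mul]
      simp
    rw [h0]
    simp only [Complex.mul_re, Complex.mul_im, Complex.add_re, Complex.add_im, Complex.sub_re,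
      Complex.sub_im, Complex.one_re, Complex.one_im, Complex.I_re, Complex.I_im, Complex.inv_re,
      Complex.inv_im, Complex.normSq_add_mul_I, Complex.ofReal_re, Complex.ofReal_im, neg_sq]
    have h5 : (Real.sinh w - Real.sin w) / (Real.cosh w - Real.cos w) =
        ((Real.exp w) ^ 2 - 1 - 2 * Real.exp w * Real.sin w) /
        ((1 - Real.exp w * Real.cos w) ^ 2 + (Real.exp w * Real.sin w) ^ 2) := by
      rw [div_eq_div_iff hpos.ne' hden.ne', Real.cosh_eq, Real.sinh_eq, Real.exp_neg]
      field_simp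
      linear_combination ((Real.exp w)^2 - 1 - 2 * Real.exp w * Real.sin w) * (Real.exp w) ^ 2 * Real.sin_sq_add_cos_sq w
    rw [h5]
    generalize hd : (1 - Real.exp w * Real.cos w) ^ 2 + (Real.exp w * Real.sin w) ^ 2 = d at *
    rw [hy]
    field_simp
    linear_combination -4 * Real.pi ^ 2 * (Real.exp w) ^ 2 * Real.sin_sq_add_cos_sq w

theorem exp_sub_cos_pos {w : ℝ} (hw : 0 < w) : 0 < Real.exp w - Real.cos w := by
  linarith [Real.one_lt_exp_iff.2 hw, Real.cos_le_one w]

theorem hasDerivAt_arctan_sin_div_exp_sub_cos {w : ℝ} (hw : 0 < w) :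
    HasDerivAt (fun w => Real.arctan (Real.sin w / (Real.exp w - Real.cos w)))
      (1 / 2 * ((Real.sinh w - Real.sin w) / (Real.cosh w - Real.cos w)) - 1 / 2) w := by
  have hD := exp_sub_cos_pos hw
  have hpos := cosh_sub_cos_pos hw.ne'
  have h := ((Real.hasDerivAt_sin w).div ((Real.hasDerivAt_exp w).sub (Real.hasDerivAt_cos w))
    hD.ne').arctan
  convert! h using 1
  simp only [Pi.sub_apply, Pi.div_apply]
  have hd : 0 < (Real.exp w - Real.cos w) ^ 2 + Real.sin w ^ 2 := by positivity
  rw [show 1 + (Real.sin w / (Real.exp w - Real.cos w)) ^ 2 =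
    ((Real.exp w - Real.cos w) ^ 2 + Real.sin w ^ 2) / (Real.exp w - Real.cos w) ^ 2 by field_simp]
  have h1 : (Real.exp w - Real.cos w) ^ 2 + Real.sin w ^ 2 =
      2 * Real.exp w * (Real.cosh w - Real.cos w) := by
    rw [Real.cosh_eq, Real.exp_neg]
    field_simp
    linear_combination Real.sin_sq_add_cos_sq w
  rw [h1]
  have h2 : Real.sinh w - Real.cosh w = -(Real.exp w)⁻¹ := by
    rw [← Real.exp_neg, ← Real.cosh_sub_sinh]; ring
  field_simp
  have h3 : Real.exp w * (Real.sinh w - Real.cosh w) = -1 := by rw [h2]; field_simp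
  linear_combination h3 + Real.sin_sq_add_cos_sq w

theorem tendsto_arctan_sin_div_exp_sub_cos_nhdsGT_zero :
    Tendsto (fun w => Real.arctan (Real.sin w / (Real.exp w - Real.cos w))) (𝓝[>] 0)
      (𝓝 (Real.pi / 4)) := by
  rw [← Real.arctan_one]
  refine (Real.continuous_arctan.tendsto 1).comp ?_
  have h1 := (Real.hasDerivAt_sin 0).tendsto_slope_zero_right
  have h2 := ((Real.hasDerivAt_exp 0).sub (Real.hasDerivAt_cos 0)).tendsto_slope_zero_right
  have h3 := h1.div h2 (by simp)
  simp only [Real.cos_zero, Real.exp_zero, Real.sin_zero, neg_zero, sub_zero, div_one] at h3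
  refine h3.congr' ?_
  filter_upwards [self_mem_nhdsWithin] with w hw
  have hw0 : w ≠ 0 := (Set.mem_Ioi.1 hw).ne'
  simp only [Pi.div_apply, Pi.sub_apply, zero_add, smul_eq_mul, Real.exp_zero, Real.cos_zero,
    sub_self, sub_zero]
  field_simp

theorem tendsto_arctan_sin_div_exp_sub_cos_atTop :
    Tendsto (fun w => Real.arctan (Real.sin w / (Real.exp w - Real.cos w))) atTop (𝓝 0) := by
  rw [← Real.arctan_zero]
  refine (Real.continuous_arctan.tendsto 0).comp ?_
  refine squeeze_zero_norm' (a := fun w : ℝ => w⁻¹) ?_ tendsto_inv_atTop_zero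
  filter_upwards [eventually_gt_atTop 0] with w hw
  rw [norm_div, ← one_div]
  have h1 : w ≤ ‖Real.exp w - Real.cos w‖ := by
    rw [Real.norm_of_nonneg (exp_sub_cos_pos hw).le]
    linarith [Real.add_one_le_exp w, Real.cos_le_one w]
  exact div_le_div₀ zero_le_one (Real.abs_sin_le_one w) hw h1

theorem summable_one_div_nat_add_one_sq : Summable fun n : ℕ => 1 / ((n : ℝ) + 1) ^ 2 := by
  simpa using (summable_nat_add_iff 1).2 (Real.summable_one_div_nat_pow.2 one_lt_two)

theorem hasDerivAt_arctan_div {c : ℝ} (hc : 0 < c) (t : ℝ) :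
    HasDerivAt (fun t => Real.arctan (t / c)) (c / (c ^ 2 + t ^ 2)) t := by
  have := ((hasDerivAt_id t).div_const c).arctan
  convert! this using 1
  simp only [id]
  field_simp

theorem abs_arctan_le_abs (x : ℝ) : |Real.arctan x| ≤ |x| := by
  have hpos {y : ℝ} (hy : 0 ≤ y) : Real.arctan y ≤ y := by
    simpa using Real.le_tan (Real.arctan_nonneg.2 hy) (Real.arctan_lt_pi_div_two y)
  have h := hpos (abs_nonneg x)
  rw [abs_le]
  constructor
  · refine (neg_le_neg h).trans ?_
    rw [← Real.arctan_neg]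
    exact Real.arctan_strictMono.monotone (neg_abs_le _)
  · exact (Real.arctan_strictMono.monotone (le_abs_self _)).trans h

theorem summable_arctan_div_sq (t : ℝ) :
    Summable fun n : ℕ => Real.arctan (t / ((n : ℝ) + 1) ^ 2) := by
  refine .of_norm_bounded (summable_one_div_nat_add_one_sq.mul_left |t|) fun n => ?_
  refine (Real.norm_eq_abs _).trans_le ((?_ : _ ≤ |t / ((n : ℝ) + 1) ^ 2|).trans_eq ?_)
  · exact abs_arctan_le_abs _
  · rw [abs_div, abs_of_pos (show (0 : ℝ) < ((n : ℝ) + 1) ^ 2 by positivity)]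
    ring

theorem hasDerivAt_tsum_arctan_div_sq (t : ℝ) :
    HasDerivAt (fun t : ℝ => ∑' n : ℕ, Real.arctan (t / ((n : ℝ) + 1) ^ 2))
      (∑' n : ℕ, ((n : ℝ) + 1) ^ 2 / (((n : ℝ) + 1) ^ 4 + t ^ 2)) t := by
  refine hasDerivAt_tsum (g := fun (n : ℕ) (t : ℝ) => Real.arctan (t / ((n : ℝ) + 1) ^ 2))
    (g' := fun (n : ℕ) (t : ℝ) => ((n : ℝ) + 1) ^ 2 / (((n : ℝ) + 1) ^ 4 + t ^ 2))
    summable_one_div_nat_add_one_sq (y₀ := 0) (fun n t => ?_) (fun n t => ?_)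
    (summable_arctan_div_sq 0) t
  · convert! hasDerivAt_arctan_div (c := ((n : ℝ) + 1) ^ 2) (by positivity) t using 2
    ring
  · rw [Real.norm_of_nonneg (by positivity), div_le_div_iff₀ (by positivity) (by positivity)]
    nlinarith [sq_nonneg t]

theorem tsum_arctan_div_sq {w : ℝ} (hw : 0 < w) :
    ∑' n : ℕ, Real.arctan (w ^ 2 / (2 * Real.pi ^ 2) / ((n : ℝ) + 1) ^ 2) =
      w / 2 + Real.arctan (Real.sin w / (Real.exp w - Real.cos w)) - Real.pi / 4 := by
  set T : ℝ → ℝ := fun t => ∑' n : ℕ, Real.arctan (t / ((n : ℝ) + 1) ^ 2) with hT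
  set A : ℝ → ℝ := fun w => Real.arctan (Real.sin w / (Real.exp w - Real.cos w)) with hA
  set F : ℝ → ℝ := fun v => T (v ^ 2 / (2 * Real.pi ^ 2)) - v / 2 - A v with hF
  have hder {v : ℝ} (hv : 0 < v) : HasDerivAt F 0 v := by
    have h1 : HasDerivAt (fun v : ℝ => v ^ 2 / (2 * Real.pi ^ 2)) (2 * v / (2 * Real.pi ^ 2)) v := by
      simpa using (hasDerivAt_pow 2 v).div_const (2 * Real.pi ^ 2)
    have h2 := (hasDerivAt_tsum_arctan_div_sq (v ^ 2 / (2 * Real.pi ^ 2))).comp v h1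
    rw [(hasSum_sq_div_pow_four_add hv).tsum_eq] at h2
    convert! (h2.sub ((hasDerivAt_id v).div_const 2)).sub
      (hasDerivAt_arctan_sin_div_exp_sub_cos hv) using 1
    field_simp
    ring
  have hconst {v : ℝ} (hv : v ∈ Set.Ioi (0 : ℝ)) : F v = F w :=
    isOpen_Ioi.is_const_of_deriv_eq_zero isPreconnected_Ioi
      (fun x hx => (hder hx).differentiableAt.differentiableWithinAt)
      (fun x hx => (hder hx).deriv) hv hw
  have hlim : Tendsto F (𝓝[>] 0) (𝓝 (T (0 ^ 2 / (2 * Real.pi ^ 2)) - 0 / 2 - Real.pi / 4)) := by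
    refine Tendsto.sub ?_ tendsto_arctan_sin_div_exp_sub_cos_nhdsGT_zero
    refine Tendsto.mono_left (Continuous.tendsto ?_ 0) nhdsWithin_le_nhds
    have hTc : Continuous T :=
      continuous_iff_continuousAt.2 fun t => (hasDerivAt_tsum_arctan_div_sq t).continuousAt
    fun_prop
  have h0 := tendsto_nhds_unique hlim
    (tendsto_const_nhds.congr' (by filter_upwards [self_mem_nhdsWithin] with v hv using (hconst hv).symm))
  have hT0 : T (0 ^ 2 / (2 * Real.pi ^ 2)) = 0 := by simp [hT]
  rw [hT0] at h0
  simp only [hF] at h0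
  linarith

theorem two_mul_div_le_arctan_sub_arctan {a : ℝ} (ha : 0 < a) {x : ℝ} (hx : 0 ≤ x) :
    2 * a / (a ^ 2 + 4 * Real.pi ^ 2 * (x + 1) ^ 2) ≤
      1 / Real.pi * (Real.arctan (2 * Real.pi * (x + 1) / a) - Real.arctan (2 * Real.pi * x / a)) := by
  have hpi := Real.pi_pos
  have hder (y : ℝ) : HasDerivAt (fun y => Real.arctan (2 * Real.pi * y / a))
      (a / (a ^ 2 + (2 * Real.pi * y) ^ 2) * (2 * Real.pi)) y :=
    (hasDerivAt_arctan_div ha (2 * Real.pi * y)).comp y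
      (by simpa using (hasDerivAt_id y).const_mul (2 * Real.pi))
  obtain ⟨ξ, hξ, h⟩ := exists_hasDerivAt_eq_slope _ _ (show x < x + 1 by linarith)
    (fun y _ => (hder y).continuousAt.continuousWithinAt) (fun y _ => hder y)
  rw [add_sub_cancel_left, div_one] at h
  rw [← h]
  have h0 : 0 ≤ ξ := hx.trans hξ.1.le
  calc 2 * a / (a ^ 2 + 4 * Real.pi ^ 2 * (x + 1) ^ 2)
      ≤ 2 * a / (a ^ 2 + 4 * Real.pi ^ 2 * ξ ^ 2) := by
        have := hξ.2.le
        gcongr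
    _ = _ := by
        field_simp
        ring

theorem hasSum_sub_of_tendsto {f : ℕ → ℝ} {l : ℝ} (hf : Monotone f)
    (h : Tendsto f atTop (𝓝 l)) : HasSum (fun n => f (n + 1) - f n) (l - f 0) := by
  rw [hasSum_iff_tendsto_nat_of_nonneg (fun n => sub_nonneg.2 (hf n.le_succ))]
  simpa only [Finset.sum_range_sub] using h.sub_const (f 0)

theorem hasSum_arctan_sub_arctan {a : ℝ} (ha : 0 < a) :
    HasSum (fun k : ℕ => 1 / Real.pi * (Real.arctan (2 * Real.pi * ((k : ℝ) + 1) / a) -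
      Real.arctan (2 * Real.pi * k / a))) (1 / 2) := by
  have hpi := Real.pi_pos
  have hmono : Monotone fun k : ℕ => Real.arctan (2 * Real.pi * k / a) := by
    intro k l hkl
    refine Real.arctan_strictMono.monotone ?_
    gcongr
  have hlim : Tendsto (fun k : ℕ => Real.arctan (2 * Real.pi * k / a)) atTop (𝓝 (Real.pi / 2)) := by
    refine (Real.tendsto_arctan_atTop.mono_right nhdsWithin_le_nhds).comp ?_
    exact (tendsto_natCast_atTop_atTop.const_mul_atTop (by positivity)).atTop_div_const ha
  convert! (hasSum_sub_of_tendsto hmono hlim).mul_left (1 / Real.pi) using 1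
  · ext k; push_cast; rfl
  · simp only [CharP.cast_eq_zero, mul_zero, zero_div, Real.arctan_zero, sub_zero]
    field_simp

theorem one_div_exp_sub_one_le {x : ℝ} (hx : 0 < x) : 1 / (Real.exp x - 1) ≤ 1 / x :=
  one_div_le_one_div_of_le hx (by linarith [Real.add_one_le_exp x])

theorem summable_one_div_exp_sq_mul_sub_one {α : ℝ} (hα : 0 < α) :
    Summable fun k : ℕ => 1 / (Real.exp (((k : ℝ) + 1) ^ 2 * α) - 1) := by
  refine .of_nonneg_of_le (fun k => ?_) (fun k => one_div_exp_sub_one_le (by positivity))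
    ((summable_one_div_nat_add_one_sq.mul_right (1 / α)).congr fun k => ?_)
  · have : 0 ≤ ((k : ℝ) + 1) ^ 2 * α := by positivity
    exact one_div_nonneg.2 (sub_nonneg.2 (Real.one_le_exp this))
  · field_simp

theorem hasSum_one_div_sq_mul (α : ℝ) :
    HasSum (fun k : ℕ => 1 / (((k : ℝ) + 1) ^ 2 * α)) (Real.pi ^ 2 / (6 * α)) := by
  have h : HasSum (fun k : ℕ => 1 / ((k : ℝ) + 1) ^ 2) (Real.pi ^ 2 / 6) := by
    simpa using (hasSum_nat_add_iff' 1).2 hasSum_zeta_two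
  convert! h.mul_right (1 / α) using 1
  · ext k; rw [one_div_mul_one_div]
  · rw [mul_one_div, div_div]

theorem hasSum_of_hasSum_of_nonpos {ι κ : Type*} {f : ι → κ → ℝ} (hf : ∀ i j, f i j ≤ 0)
    {u : ι → ℝ} {v : κ → ℝ} (hu : ∀ i, HasSum (f i) (u i)) (hv : ∀ j, HasSum (fun i => f i j) (v j))
    {s : ℝ} (hs : HasSum u s) : HasSum v s := by
  have h : Summable fun p : ι × κ => f p.1 p.2 := by
    rw [← summable_neg_iff]
    refine (summable_prod_of_nonneg fun p => neg_nonneg.2 (hf p.1 p.2)).2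
      ⟨fun i => (hu i).summable.neg, ?_⟩
    convert! hs.summable.neg using 2 with i
    exact (hu i).neg.tsum_eq
  have h1 := (h.hasSum.prod_fiberwise hu).unique hs
  have h2 := ((Equiv.prodComm κ ι).hasSum_iff.2 h.hasSum).prod_fiberwise hv
  rwa [h1] at h2

theorem one_add_sq_div_two_le_cosh {w : ℝ} (hw : 0 ≤ w) : 1 + w ^ 2 / 2 ≤ Real.cosh w := by
  have h1 : w / 2 ≤ Real.sinh (w / 2) := Real.self_le_sinh_iff.2 (by positivity)
  have h2 := Real.cosh_two_mul (w / 2)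
  rw [mul_div_cancel₀ w two_ne_zero, Real.cosh_sq] at h2
  nlinarith

theorem abs_cos_sub_sin_sub_exp_div_le {w : ℝ} (hw : 0 < w) :
    |(Real.cos w - Real.sin w - Real.exp (-w)) / (Real.cosh w - Real.cos w)| ≤ 6 / w ^ 2 := by
  have h1 : w ^ 2 / 2 ≤ Real.cosh w - Real.cos w := by
    linarith [one_add_sq_div_two_le_cosh hw.le, Real.cos_le_one w]
  have h2 : |Real.cos w - Real.sin w - Real.exp (-w)| ≤ 3 := by
    have h4 : Real.exp (-w) ≤ 1 := Real.exp_le_one_iff.2 (by linarith)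
    have h5 := Real.exp_pos (-w)
    rw [abs_le]
    constructor <;> linarith [Real.cos_le_one w, Real.neg_one_le_cos w, Real.sin_le_one w,
      Real.neg_one_le_sin w]
  have h3 : 0 < w ^ 2 / 2 := by positivity
  rw [abs_div, abs_of_pos (h3.trans_le h1)]
  calc _ ≤ 3 / (w ^ 2 / 2) := div_le_div₀ (by norm_num) h2 h3 h1
    _ = 6 / w ^ 2 := by field_simp; norm_num

theorem summable_cos_sub_sin_sub_exp_div {β : ℝ} (hβ : 0 < β) :
    Summable fun k : ℕ =>
      (Real.cos (√(((k : ℝ) + 1) * β)) - Real.sin (√(((k : ℝ) + 1) * β)) -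
          Real.exp (-√(((k : ℝ) + 1) * β))) /
        (√((k : ℝ) + 1) * (Real.cosh (√(((k : ℝ) + 1) * β)) - Real.cos (√(((k : ℝ) + 1) * β)))) := by
  have hs : Summable fun k : ℕ => 6 / β * ((k : ℝ) + 1) ^ (-(3 / 2) : ℝ) := by
    refine Summable.mul_left _ ?_
    simpa using (summable_nat_add_iff 1).2 (Real.summable_nat_rpow (p := -(3 / 2)).2 (by norm_num))
  refine .of_norm_bounded hs fun k => ?_
  have hk : (0 : ℝ) < (k : ℝ) + 1 := by positivity
  have h := abs_cos_sub_sin_sub_exp_div_le (w := √(((k : ℝ) + 1) * β)) (by positivity)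
  rw [Real.sq_sqrt (by positivity)] at h
  rw [mul_comm (√((k : ℝ) + 1)), ← div_div, norm_div, Real.norm_eq_abs, Real.norm_eq_abs,
    abs_of_pos (Real.sqrt_pos.2 hk), div_le_iff₀ (Real.sqrt_pos.2 hk), Real.sqrt_eq_rpow ((k : ℝ) + 1),
    mul_assoc, ← Real.rpow_add hk]
  norm_num only
  rw [Real.rpow_neg_one]
  refine h.trans_eq ?_
  field_simp

theorem hasSum_two_mul_div_sq_add {α β : ℝ} (hα : 0 < α) (hβ : 0 < β)
    (h : α * β = 4 * Real.pi ^ 3) {x : ℝ} (hx : 0 < x) :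
    HasSum (fun n : ℕ => 2 * (((n : ℝ) + 1) ^ 2 * α) /
        ((((n : ℝ) + 1) ^ 2 * α) ^ 2 + 4 * Real.pi ^ 2 * x ^ 2))
      (√β / (4 * Real.pi) * (1 / √x + (Real.cos (√(x * β)) - Real.sin (√(x * β)) -
          Real.exp (-√(x * β))) / (√x * (Real.cosh (√(x * β)) - Real.cos (√(x * β)))))) := by
  have hpi := Real.pi_pos
  have hβ' : β = 4 * Real.pi ^ 3 / α := by rw [← h]; field_simp
  have hw : 0 < √(x * β) := by positivity
  have hs := (hasSum_sq_div_pow_four_add hw).mul_left (2 / α)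
  rw [Real.sq_sqrt (by positivity)] at hs
  convert! hs using 1
  · ext n
    rw [hβ']
    field_simp
    ring
  · have hpos := cosh_sub_cos_pos hw.ne'
    have hsqx : √(x * β) = √x * √β := Real.sqrt_mul hx.le β
    have hα' : α = 4 * Real.pi ^ 3 / β := by rw [← h]; field_simp
    have hβs : √β * √β = β := Real.mul_self_sqrt hβ.le
    have h1 : Real.sinh (√(x * β)) = Real.cosh (√(x * β)) - Real.exp (-√(x * β)) := by
      rw [← Real.cosh_sub_sinh]; ring
    rw [h1]
    generalize Real.cosh (√(x * β)) = c at *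
    generalize Real.cos (√(x * β)) = d at *
    rw [hα', show 2 * √(x * β) = 2 * (√x * √β) by rw [hsqx]]
    generalize Real.exp (-√(x * β)) = e
    generalize Real.sin (√(x * β)) = f
    have hx' : 0 < √x := by positivity
    have hb' : 0 < √β := by positivity
    clear hα' hsqx hβ' hs h h1
    generalize √β = b at *
    rw [← hβs]
    field_simp
    ring

theorem hasSum_arctan_sqrt {α β : ℝ} (hα : 0 < α) (hβ : 0 < β)
    (h : α * β = 4 * Real.pi ^ 3) {x : ℝ} (hx : 0 < x) :
    HasSum (fun n : ℕ => 1 / Real.pi * Real.arctan (2 * Real.pi * x / (((n : ℝ) + 1) ^ 2 * α)))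
      (√β / (4 * Real.pi) * (2 * √x) + 1 / Real.pi * Real.arctan (Real.sin (√(x * β)) /
        (Real.exp (√(x * β)) - Real.cos (√(x * β)))) - 1 / 4) := by
  have hpi := Real.pi_pos
  have hβ' : β = 4 * Real.pi ^ 3 / α := by rw [← h]; field_simp
  have hw : 0 < √(x * β) := by positivity
  have hs := (summable_arctan_div_sq (√(x * β) ^ 2 / (2 * Real.pi ^ 2))).hasSum.mul_left (1 / Real.pi)
  rw [tsum_arctan_div_sq hw, Real.sq_sqrt (by positivity)] at hs
  convert! hs using 1
  · ext n
    congr 2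
    rw [hβ']
    field_simp
    ring
  · nth_rw 4 [Real.sqrt_mul hx.le β]
    field_simp
    ring

theorem tsum_one_div_exp_sq_mul_sub_one {α β : ℝ} (hα : 0 < α) (hβ : 0 < β)
    (h : α * β = 4 * Real.pi ^ 3) :
    ((∑' k : ℕ, 1 / (Real.exp (((k : ℝ) + 1) ^ 2 * α) - 1) : ℝ) : ℂ) =
      ((Real.pi ^ 2 / (6 * α) + 1 / 4 : ℝ) : ℂ) +
        ((√β / (4 * Real.pi) : ℝ) : ℂ) *
          (riemannZeta (1 / 2) +
            ((∑' k : ℕ,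
                (Real.cos (√(((k : ℝ) + 1) * β)) - Real.sin (√(((k : ℝ) + 1) * β)) -
                    Real.exp (-√(((k : ℝ) + 1) * β))) /
                  (√((k : ℝ) + 1) * (Real.cosh (√(((k : ℝ) + 1) * β)) -
                      Real.cos (√(((k : ℝ) + 1) * β)))) : ℝ) : ℂ)) := by
  set E : ℕ → ℝ := fun k => (Real.cos (√(((k : ℝ) + 1) * β)) - Real.sin (√(((k : ℝ) + 1) * β)) -
      Real.exp (-√(((k : ℝ) + 1) * β))) / (√((k : ℝ) + 1) * (Real.cosh (√(((k : ℝ) + 1) * β)) -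
      Real.cos (√(((k : ℝ) + 1) * β))))
  set c : ℝ := √β / (4 * Real.pi)
  set A : ℝ → ℝ := fun w => Real.arctan (Real.sin w / (Real.exp w - Real.cos w))
  set a : ℕ → ℝ := fun n => ((n : ℝ) + 1) ^ 2 * α
  have ha (n : ℕ) : 0 < a n := by positivity
  set J : ℕ → ℝ := fun k => ∑' n : ℕ, 1 / Real.pi * Real.arctan (2 * Real.pi * k / a n) with hJ
  have hJsum (k : ℕ) : HasSum (fun n : ℕ => 1 / Real.pi * Real.arctan (2 * Real.pi * k / a n)) (J k) := by
    rcases k.eq_zero_or_pos with rfl | hk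
    · simp [hJ, hasSum_zero]
    · exact (hasSum_arctan_sqrt hα hβ h (x := k) (by exact_mod_cast hk)).summable.hasSum
  have hJ0 : J 0 = 0 := by simp [hJ]
  have hJpos {k : ℕ} (hk : 0 < k) : J k = c * (2 * √k) + 1 / Real.pi * A (√(k * β)) - 1 / 4 :=
    (hasSum_arctan_sqrt hα hβ h (x := k) (by exact_mod_cast hk)).tsum_eq
  have hswap : HasSum (fun k : ℕ => c * (1 / √((k : ℝ) + 1) + E k) - (J (k + 1) - J k))
      (∑' k : ℕ, 1 / (Real.exp (((k : ℝ) + 1) ^ 2 * α) - 1) - Real.pi ^ 2 / (6 * α)) := by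
    refine hasSum_of_hasSum_of_nonpos
      (f := fun n k : ℕ => 2 * a n / (a n ^ 2 + 4 * Real.pi ^ 2 * ((k : ℝ) + 1) ^ 2) -
        1 / Real.pi * (Real.arctan (2 * Real.pi * ((k : ℝ) + 1) / a n) -
          Real.arctan (2 * Real.pi * k / a n)))
      (fun n k => sub_nonpos.2 (two_mul_div_le_arctan_sub_arctan (ha n) k.cast_nonneg))
      (fun n => (hasSum_inv_exp_sub_one_partial_fractions (ha n)).sub
        (hasSum_arctan_sub_arctan (ha n))) (fun k => ?_) ?_
    · refine (hasSum_two_mul_div_sq_add hα hβ h (by positivity)).sub ?_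
      simpa only [mul_sub, Nat.cast_add, Nat.cast_one] using (hJsum (k + 1)).sub (hJsum k)
    · convert! (summable_one_div_exp_sq_mul_sub_one hα).hasSum.sub (hasSum_one_div_sq_mul α) using 2
      simp only [a]
      ring
  have hEsum : HasSum E (∑' k, E k) := (summable_cos_sub_sin_sub_exp_div hβ).hasSum
  have hAlim : Tendsto (fun N : ℕ => A (√(N * β))) atTop (𝓝 0) :=
    tendsto_arctan_sin_div_exp_sub_cos_atTop.comp (Real.tendsto_sqrt_atTop.comp
      (tendsto_natCast_atTop_atTop.atTop_mul_const hβ))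
  have hlim := (Complex.continuous_ofReal.tendsto _).comp hswap.tendsto_sum_nat
  have hlim' : Tendsto (fun N : ℕ =>
      (c : ℂ) * (((∑ k ∈ Finset.range N, 1 / √((k : ℝ) + 1) - 2 * √N : ℝ) : ℂ) +
        ((∑ k ∈ Finset.range N, E k : ℝ) : ℂ)) -
        ((1 / Real.pi * A (√(N * β)) : ℝ) : ℂ) + ((1 / 4 : ℝ) : ℂ)) atTop
      (𝓝 ((c : ℂ) * (riemannZeta (1 / 2) + ((∑' k, E k : ℝ) : ℂ)) -
        ((1 / Real.pi * 0 : ℝ) : ℂ) + ((1 / 4 : ℝ) : ℂ))) :=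
    (((tendsto_sum_inv_sqrt_sub_two_mul_sqrt.add
      ((Complex.continuous_ofReal.tendsto _).comp hEsum.tendsto_sum_nat)).const_mul _).sub
      ((Complex.continuous_ofReal.tendsto _).comp (hAlim.const_mul _))).add_const _
  have hu := tendsto_nhds_unique hlim (hlim'.congr' ?_)
  · rw [Complex.ofReal_sub, sub_eq_iff_eq_add] at hu
    rw [hu]
    push_cast
    ring
  · filter_upwards [eventually_gt_atTop 0] with N hN
    rw [Function.comp_apply, Finset.sum_sub_distrib, Finset.sum_range_sub J, hJ0, hJpos hN,
      ← Finset.mul_sum, Finset.sum_add_distrib]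
    push_cast
    ring

end

/-- Ramanujan's formula relating `ζ(1/2)` to two rapidly convergent
series. For real `α, β > 0` with `αβ = 4π³`,
`∑_{n=1}^∞ 1/(e^(n²α) - 1) = π²/(6α) + 1/4 + (√β/(4π)) [ζ(1/2)
  + ∑_{n=1}^∞ (cos √(nβ) - sin √(nβ) - e^(-√(nβ))) / (√n (cosh √(nβ) - cos √(nβ)))]`,
and both series converge (sums indexed by `n = k + 1`, `k ≥ 0`). -/
theorem ramanujan_zeta_half (α β : ℝ) (hα : 0 < α) (hβ : 0 < β)
    (h : α * β = 4 * Real.pi ^ 3) :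
    Summable (fun k : ℕ => 1 / (Real.exp (((k : ℝ) + 1) ^ 2 * α) - 1)) ∧
    Summable (fun k : ℕ =>
      (Real.cos (Real.sqrt (((k : ℝ) + 1) * β)) - Real.sin (Real.sqrt (((k : ℝ) + 1) * β)) -
          Real.exp (-Real.sqrt (((k : ℝ) + 1) * β))) /
        (Real.sqrt ((k : ℝ) + 1) *
          (Real.cosh (Real.sqrt (((k : ℝ) + 1) * β)) -
            Real.cos (Real.sqrt (((k : ℝ) + 1) * β))))) ∧
    ((∑' k : ℕ, 1 / (Real.exp (((k : ℝ) + 1) ^ 2 * α) - 1) : ℝ) : ℂ) =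
      ((Real.pi ^ 2 / (6 * α) + 1 / 4 : ℝ) : ℂ) +
        ((Real.sqrt β / (4 * Real.pi) : ℝ) : ℂ) *
          (riemannZeta (1 / 2) +
            ((∑' k : ℕ,
                (Real.cos (Real.sqrt (((k : ℝ) + 1) * β)) -
                    Real.sin (Real.sqrt (((k : ℝ) + 1) * β)) -
                    Real.exp (-Real.sqrt (((k : ℝ) + 1) * β))) /
                  (Real.sqrt ((k : ℝ) + 1) *
                    (Real.cosh (Real.sqrt (((k : ℝ) + 1) * β)) -
                      Real.cos (Real.sqrt (((k : ℝ) + 1) * β)))) : ℝ) : ℂ)) := by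
  exact ⟨summable_one_div_exp_sq_mul_sub_one hα, summable_cos_sub_sin_sub_exp_div hβ,
    tsum_one_div_exp_sq_mul_sub_one hα hβ h⟩
end
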